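/- arXiv:2006.15712 — 9 statements merged into one kernel-verified Lean document; each statement's English description precedes it below -/
import Mathlib

section
/- Suppose C := ∑_{n=0}^∞ ∏_{i=0}^{n−1} λ(i)/μ(i+1) < ∞ and suppose θ : K → ℝ is nonnegative with ∑_{k∈K} θ(k) = 1 and satisfies ∑_{m∈K} θ(m)·q̃_red^{(n)}(m,k) = 0 for every n ∈ ℕ and every k ∈ K. Then π : E → ℝ defined by π(n,k) = C^{−1}·(∏_{i=0}^{n−1} λ(i)/μ(i+1))·θ(k) is nonnegative, ∑_{(n,k)∈E} π(n,k) = 1, and π satisfies the global balance equations ∑_{z∈E} π(z)·q(z;z̃) = 0 for every z̃ ∈ E. (Theorem 3.1(b), direction (ii)⇒(i)) -/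
open scoped Classical

noncomputable section

/-- Off-diagonal transition rates of the queueing-environment generator `Q` on `E = ℕ × K`. -/
def qoff {K : Type*} (KW : Set K) (lam mu : ℕ → ℝ) (R V : ℕ → K → K → ℝ)
    (z z' : ℕ × K) : ℝ :=
  if z' = z then 0
  else if z'.1 = z.1 + 1 ∧ z'.2 = z.2 then (if z.2 ∈ KW then lam z.1 else 0)
  else if z'.1 + 1 = z.1 then (if z.2 ∈ KW then mu z.1 * R z.1 z.2 z'.2 else 0)
  else if z'.1 = z.1 then V z.1 z.2 z'.2
  else 0

/-- The queueing-environment generator `Q` on `E = ℕ × K`, with conservative diagonal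
`q(z;z) = −∑_{z̃ ≠ z} q(z;z̃)`. -/
def qgen {K : Type*} (KW : Set K) (lam mu : ℕ → ℝ) (R V : ℕ → K → K → ℝ)
    (z z' : ℕ × K) : ℝ :=
  if z' = z then -∑' w : ℕ × K, qoff KW lam mu R V z w
  else qoff KW lam mu R V z z'

/-- The reduced generator `Q̃_red^{(n)}` on the environment space `K`. -/
def qred {K : Type*} (KW : Set K) (lam : ℕ → ℝ) (R V : ℕ → K → K → ℝ)
    (n : ℕ) (k m : K) : ℝ :=
  if m = k then
    -((if k ∈ KW then lam n * (1 - R (n + 1) k k) else 0)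
      + ∑' m' : K, (if m' = k then 0 else V n k m'))
  else (if k ∈ KW then lam n * R (n + 1) k m else 0) + V n k m

/-- A function supported on one level `{j} × K` has the sum of its restriction to that level. -/
theorem hasSum_ite_fst_eq {K : Type*} {h : K → ℝ} {a : ℝ} (j : ℕ) (ha : HasSum h a) :
    HasSum (fun z : ℕ × K => if z.1 = j then h z.2 else 0) a := by
  refine ((Prod.mk_right_injective j).hasSum_iff ?_).1 ?_
  · rintro ⟨i, k⟩ hz
    have hij : i ≠ j := by
      rintro rfl
      exact hz ⟨k, rfl⟩
    simp [hij]
  · simpa [Function.comp_def] using ha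

theorem qoff_eq_add {K : Type*} (KW : Set K) (lam mu : ℕ → ℝ) (R V : ℕ → K → K → ℝ)
    (n : ℕ) (k : K) (w : ℕ × K) :
    qoff KW lam mu R V (n, k) w =
      (if w.1 = n + 1 then (if w.2 = k then (if k ∈ KW then lam n else 0) else 0) else 0)
      + (if w.1 = n - 1 then
          (if 0 < n then (if k ∈ KW then mu n else 0) else 0) * R n k w.2 else 0)
      + (if w.1 = n then (if w.2 = k then 0 else V n k w.2) else 0) := by
  obtain ⟨j, m⟩ := w
  simp only [qoff, Prod.mk.injEq]
  rcases Nat.eq_zero_or_pos n with rfl | hn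
  · split_ifs <;> first | omega | simp_all
  · split_ifs <;> first | omega | simp_all

/-- The total exit rate of a state. -/
theorem hasSum_qoff {K : Type*} (KW : Set K) (lam mu : ℕ → ℝ) (R V : ℕ → K → K → ℝ)
    (hmu0 : mu 0 = 0) (hRrow : ∀ n, 0 < n → ∀ k, HasSum (R n k) 1)
    (hVsum : ∀ n k, Summable (V n k)) (n : ℕ) (k : K) :
    HasSum (qoff KW lam mu R V (n, k))
      ((if k ∈ KW then lam n else 0) + (if k ∈ KW then mu n else 0)
        + ∑' m, (if m = k then 0 else V n k m)) := by
  rw [funext (qoff_eq_add KW lam mu R V n k)]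
  refine ((hasSum_ite_fst_eq (n + 1) (hasSum_ite_eq k _)).add
    (hasSum_ite_fst_eq (n - 1) (h := fun m =>
      (if 0 < n then (if k ∈ KW then mu n else 0) else 0) * R n k m) ?_)).add
    (hasSum_ite_fst_eq n (h := fun m => if m = k then 0 else V n k m) (Summable.hasSum ?_))
  · rcases Nat.eq_zero_or_pos n with rfl | hn
    · simp [hmu0]
    · simpa [hn] using (hRrow n hn k).mul_left (if k ∈ KW then mu n else 0)
  · refine (summable_congr_cofinite ?_).1 (hVsum n k)
    filter_upwards [(Set.finite_singleton k).compl_mem_cofinite] with m hm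
    have : m ≠ k := hm
    simp [this]

/-- The inflow into `(n, k)`, split by the level it comes from. -/
theorem mul_qgen_eq_add {K : Type*} (KW : Set K) (lam mu : ℕ → ℝ) (R V : ℕ → K → K → ℝ)
    (p : ℕ × K → ℝ) (n : ℕ) (k : K) (z : ℕ × K) :
    p z * qgen KW lam mu R V z (n, k) =
      (if z.1 = n then (if z.2 = k then
          -(p (n, k) * ∑' w, qoff KW lam mu R V (n, k) w) else p (n, z.2) * V n z.2 k) else 0)
      + (if z.1 = n + 1 then
          p (n + 1, z.2) * (if z.2 ∈ KW then mu (n + 1) * R (n + 1) z.2 k else 0) else 0)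
      + (if z.1 = n - 1 then (if z.2 = k then
          (if 0 < n then p (n - 1, k) * (if k ∈ KW then lam (n - 1) else 0) else 0)
          else 0) else 0) := by
  obtain ⟨j, m⟩ := z
  by_cases hj : j = n
  · subst hj
    by_cases hm : m = k
    · subst hm
      rcases Nat.eq_zero_or_pos j with rfl | hn
      · simp [qgen]
      · have : j ≠ j - 1 := by omega
        simp [qgen, this]
    · have hm' : k ≠ m := fun h => hm h.symm
      simp [qgen, qoff, hm, hm']
  · have hj' : n ≠ j := fun h => hj h.symm
    by_cases h1 : j = n + 1
    · subst h1
      have : n + 1 ≠ n - 1 := by omega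
      simp [qgen, qoff, this]
      omega
    · have h1' : n + 1 ≠ j := fun h => h1 h.symm
      by_cases h2 : n = j + 1
      · subst h2
        by_cases hm : m = k
        · subst hm
          simp [qgen, qoff]
          omega
        · have hm' : k ≠ m := fun h => hm h.symm
          simp [qgen, qoff, hm, hm', h1]
          omega
      · have h3 : j ≠ n - 1 := by omega
        simp [qgen, qoff, hj, hj', h1, h1', h2, h3]

theorem mul_qred_eq_add {K : Type*} (KW : Set K) (lam : ℕ → ℝ) (R V : ℕ → K → K → ℝ)
    (theta : K → ℝ) (n : ℕ) (m k : K) :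
    theta m * qred KW lam R V n m k =
      (if m = k then 0 else theta m * V n m k)
      + lam n * (theta m * (if m ∈ KW then R (n + 1) m k else 0))
      + (if m = k then -(theta k * ((if k ∈ KW then lam n else 0)
          + ∑' m', (if m' = k then 0 else V n k m'))) else 0) := by
  by_cases hm : m = k
  · subst hm
    by_cases hk : m ∈ KW
    · simp [qred, hk]
      ring
    · simp [qred, hk]
  · have hm' : k ≠ m := fun h => hm h.symm
    by_cases hk : m ∈ KW <;> simp [qred, hm, hm', hk]
    ring

/-- Theorem 3.1(b), direction (ii) ⇒ (i): under the summability condition and a common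
stochastic solution `θ` of all reduced-generator equations, the product-form vector
`π(n,k) = C⁻¹·(∏_{i<n} λ(i)/μ(i+1))·θ(k)` is a probability distribution solving the
global balance equations of `Q`. -/
theorem product_form_of_reduced_solution
    {K : Type*} [Countable K] [Nonempty K]
    (KW : Set K) (hKW : KW.Nonempty)
    (lam mu : ℕ → ℝ) (R V : ℕ → K → K → ℝ)
    (hlam : ∀ n, 0 < lam n)
    (hmu0 : mu 0 = 0) (hmu : ∀ n, 0 < n → 0 < mu n)
    (hRnn : ∀ n, 0 < n → ∀ k m, 0 ≤ R n k m)
    (hRrow : ∀ n, 0 < n → ∀ k, HasSum (R n k) 1)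
    (hVoff : ∀ n k m, m ≠ k → 0 ≤ V n k m)
    (hVsum : ∀ n k, Summable (V n k))
    (hVrow : ∀ n k, ∑' m, V n k m = 0)
    (hC : Summable (fun n : ℕ => ∏ i ∈ Finset.range n, lam i / mu (i + 1)))
    (theta : K → ℝ) (hth0 : ∀ k, 0 ≤ theta k) (hth1 : ∑' k : K, theta k = 1)
    (hthQ : ∀ (n : ℕ) (k : K), ∑' m : K, theta m * qred KW lam R V n m k = 0) :
    (∀ z : ℕ × K, 0 ≤
        (∑' n : ℕ, ∏ i ∈ Finset.range n, lam i / mu (i + 1))⁻¹ *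
          (∏ i ∈ Finset.range z.1, lam i / mu (i + 1)) * theta z.2) ∧
    (∑' z : ℕ × K,
        (∑' n : ℕ, ∏ i ∈ Finset.range n, lam i / mu (i + 1))⁻¹ *
          (∏ i ∈ Finset.range z.1, lam i / mu (i + 1)) * theta z.2) = 1 ∧
    (∀ z' : ℕ × K,
      ∑' z : ℕ × K,
        ((∑' n : ℕ, ∏ i ∈ Finset.range n, lam i / mu (i + 1))⁻¹ *
          (∏ i ∈ Finset.range z.1, lam i / mu (i + 1)) * theta z.2) *
          qgen KW lam mu R V z z' = 0) := by
  set c : ℝ := ∑' n : ℕ, ∏ i ∈ Finset.range n, lam i / mu (i + 1) with hc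
  set W : ℕ → ℝ := fun n => ∏ i ∈ Finset.range n, lam i / mu (i + 1) with hW
  have hWpos : ∀ n, 0 < W n := fun n =>
    Finset.prod_pos fun i _ => div_pos (hlam i) (hmu _ i.succ_pos)
  have hcpos : 0 < c := hC.tsum_pos (fun n => (hWpos n).le) 0 (hWpos 0)
  have hths : Summable theta := by
    by_contra h
    simp [tsum_eq_zero_of_not_summable h] at hth1
  have hWsucc : ∀ n, W (n + 1) * mu (n + 1) = W n * lam n := by
    intro n
    have := (hmu (n + 1) n.succ_pos).ne'
    simp only [hW, Finset.prod_range_succ]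
    field_simp
  refine ⟨fun z => mul_nonneg (mul_nonneg (inv_nonneg.2 hcpos.le) (hWpos z.1).le) (hth0 z.2),
    ?_, ?_⟩
  · have h := ((hC.hasSum.mul_left c⁻¹).mul (hths.hasSum) ((hC.mul_left c⁻¹).mul_of_nonneg hths
      (fun n => mul_nonneg (inv_nonneg.2 hcpos.le) (hWpos n).le) hth0)).tsum_eq
    rw [hth1, mul_one, ← hc, inv_mul_cancel₀ hcpos.ne'] at h
    exact h
  rintro ⟨n, k⟩
  have hdecomp := fun z => mul_qgen_eq_add KW lam mu R V
    (fun z => c⁻¹ * W z.1 * theta z.2) n k z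
  by_cases hv : Summable fun m => if m = k then 0 else theta m * V n m k
  · have hr : Summable fun m => theta m * (if m ∈ KW then R (n + 1) m k else 0) := by
      refine Summable.of_nonneg_of_le (fun m => ?_) (fun m => ?_) hths
      · refine mul_nonneg (hth0 m) ?_
        split_ifs
        exacts [hRnn _ n.succ_pos _ _, le_rfl]
      · refine mul_le_of_le_one_right (hth0 m) ?_
        split_ifs
        exacts [le_hasSum (hRrow _ n.succ_pos m) k fun j _ => hRnn _ n.succ_pos _ _, zero_le_one]
    have hred := ((hv.hasSum.add (hr.hasSum.mul_left (lam n))).add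
      (hasSum_ite_eq k (-(theta k * ((if k ∈ KW then lam n else 0)
          + ∑' m', (if m' = k then 0 else V n k m')))))).tsum_eq
    simp only [← mul_qred_eq_add, hthQ] at hred
    have hlevel := hasSum_ite_fst_eq n (h := fun m => if m = k then
        -(c⁻¹ * W n * theta k * ∑' w, qoff KW lam mu R V (n, k) w)
        else c⁻¹ * W n * theta m * V n m k)
      (((hv.hasSum.mul_left (c⁻¹ * W n)).add (hasSum_ite_eq k
        (-(c⁻¹ * W n * theta k * ∑' w, qoff KW lam mu R V (n, k) w)))).congr_fun fun m => by
          split_ifs <;> ring)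
    have habove := hasSum_ite_fst_eq (n + 1) (h := fun m => c⁻¹ * W (n + 1) * theta m *
        (if m ∈ KW then mu (n + 1) * R (n + 1) m k else 0))
      ((hr.hasSum.mul_left (c⁻¹ * (W (n + 1) * mu (n + 1)))).congr_fun fun m => by
          split_ifs <;> ring)
    have hbelow := hasSum_ite_fst_eq (n - 1) (hasSum_ite_eq k
      (if 0 < n then c⁻¹ * W (n - 1) * theta k * (if k ∈ KW then lam (n - 1) else 0) else 0))
    have hin : (if 0 < n then c⁻¹ * W (n - 1) * theta k * (if k ∈ KW then lam (n - 1) else 0)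
        else 0) = c⁻¹ * W n * theta k * (if k ∈ KW then mu n else 0) := by
      cases n with
      | zero => simp [hmu0]
      | succ j =>
        have := hWsucc j
        simp only [Nat.succ_pos, if_true, Nat.add_sub_cancel]
        split_ifs
        · linear_combination (-(c⁻¹ * theta k)) * this
        · simp
    have hsum := ((hlevel.add habove).add hbelow).tsum_eq
    rw [tsum_congr hdecomp]
    refine hsum.trans ?_
    rw [hin, hWsucc, (hasSum_qoff KW lam mu R V hmu0 hRrow hVsum n k).tsum_eq]
    linear_combination (-(c⁻¹ * W n)) * hred
  · refine tsum_eq_zero_of_not_summable fun hs => hv ?_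
    have hn := (hs.comp_injective (Prod.mk_right_injective n)).mul_left (c⁻¹ * W n)⁻¹
    refine (summable_congr_cofinite ?_).1 hn
    filter_upwards [(Set.finite_singleton k).compl_mem_cofinite] with m hm
    have hm : m ≠ k := hm
    have hne : c⁻¹ * W n ≠ 0 := (mul_pos (inv_pos.2 hcpos) (hWpos n)).ne'
    have hq : qgen KW lam mu R V (n, m) (n, k) = V n m k := by
      simp [qgen, qoff, hm.symm]
    change (c⁻¹ * W n)⁻¹ * (c⁻¹ * W n * theta m * qgen KW lam mu R V (n, m) (n, k)) = _
    rw [hq, if_neg hm, mul_assoc, inv_mul_cancel_left₀ hne]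
end
end

section
/- Let θ : K → ℝ be nonnegative and summable and set ξ(n) = ∏_{i=0}^{n−1} λ(i)/μ(i+1) and π(n,k) = ξ(n)·θ(k) for (n,k) ∈ E. Then for every fixed n ∈ ℕ and k ∈ K, the global balance equation of Q at state (n,k), i.e. ∑_{z∈E} π(z)·q(z;(n,k)) = 0, holds if and only if ∑_{m∈K} θ(m)·q̃_red^{(n)}(m,k) = 0. (Identity (14) in the proof of Theorem 3.1) -/
open scoped Classical

noncomputable section

/-- Putting a function on one level of a product does not change its sum. -/
lemma HasSum.level {K : Type*} (j : ℕ) {g : K → ℝ} {a : ℝ} (h : HasSum g a) :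
    HasSum (fun z : ℕ × K => if z.1 = j then g z.2 else 0) a := by
  have hinj : Function.Injective (fun m : K => (j, m)) := fun x y hxy => by simpa using hxy
  refine (hinj.hasSum_iff ?_).1 (by simpa [Function.comp_def] using h)
  rintro ⟨i, m⟩ hz
  have hij : i ≠ j := by
    rintro rfl
    exact hz ⟨m, rfl⟩
  simp [hij]

lemma tsum_level {K : Type*} (j : ℕ) (g : K → ℝ) :
    ∑' z : ℕ × K, (if z.1 = j then g z.2 else 0) = ∑' m, g m := by
  have hinj : Function.Injective (fun m : K => (j, m)) := fun x y hxy => by simpa using hxy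
  rw [← hinj.tsum_eq (f := fun z : ℕ × K => if z.1 = j then g z.2 else 0)]
  · simp
  · rintro ⟨i, m⟩ hz
    have hij : i = j := by
      by_contra hij
      simp [hij] at hz
    exact ⟨m, by simp [hij]⟩

/-- Adding a function with sum zero never changes an unconditional sum, summable or not. -/
lemma tsum_add_of_hasSum_zero {ι : Type*} (f : ι → ℝ) {h : ι → ℝ} (hh : HasSum h 0) :
    ∑' i, (f i + h i) = ∑' i, f i := by
  by_cases hf : Summable f
  · rw [hf.tsum_add hh.summable, hh.tsum_eq, add_zero]
  · rw [tsum_eq_zero_of_not_summable hf, tsum_eq_zero_of_not_summable]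
    exact fun hs => hf (by simpa using hs.sub hh.summable)

/-- The total exit rate of a state under `Q`. -/
lemma tsum_qoff {K : Type*} (KW : Set K) (lam mu : ℕ → ℝ) (R V : ℕ → K → K → ℝ)
    (hmu0 : mu 0 = 0) (hRrow : ∀ n, 0 < n → ∀ k, HasSum (R n k) 1)
    (hVsum : ∀ n k, Summable (V n k)) (n : ℕ) (k : K) :
    ∑' w : ℕ × K, qoff KW lam mu R V (n, k) w =
      (if k ∈ KW then lam n else 0) + (if k ∈ KW then mu n else 0)
        + ∑' m : K, (if m = k then 0 else V n k m) := by
  have hup : HasSum (fun w : ℕ × K => if w = (n + 1, k) then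
      (if k ∈ KW then lam n else 0) else 0) (if k ∈ KW then lam n else 0) :=
    hasSum_ite_eq _ _
  have hdown : HasSum (fun m : K => if k ∈ KW then mu n * R n k m else 0)
      (if k ∈ KW then mu n else 0) := by
    by_cases hk : k ∈ KW
    · rcases Nat.eq_zero_or_pos n with rfl | hn
      · simp [hk, hmu0]
      · simpa [hk] using (hRrow n hn k).mul_left (mu n)
    · simp [hk]
  have hV : Summable (fun m : K => if m = k then 0 else V n k m) := by
    refine Summable.of_norm_bounded (hVsum n k).norm fun m => ?_
    split_ifs <;> simp
  rw [← ((hup.add (hdown.level (n - 1))).add (hV.hasSum.level n)).tsum_eq]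
  refine tsum_congr ?_
  rintro ⟨i, m⟩
  rcases Nat.eq_zero_or_pos n with rfl | hn
  · simp only [qoff, Prod.mk.injEq, hmu0]
    grind
  · simp only [qoff, Prod.mk.injEq]
    grind

/-- Identity (14) in the proof of Theorem 3.1: for `π(n,k) = ξ(n)·θ(k)` with
`ξ(n) = ∏_{i<n} λ(i)/μ(i+1)`, the global balance equation of `Q` at a fixed state `(n,k)`
holds if and only if `∑_m θ(m)·q̃_red^{(n)}(m,k) = 0`. -/
theorem global_balance_iff_reduced_equation
    {K : Type*} [Countable K] [Nonempty K]
    (KW : Set K) (hKW : KW.Nonempty)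
    (lam mu : ℕ → ℝ) (R V : ℕ → K → K → ℝ)
    (hlam : ∀ n, 0 < lam n)
    (hmu0 : mu 0 = 0) (hmu : ∀ n, 0 < n → 0 < mu n)
    (hRnn : ∀ n, 0 < n → ∀ k m, 0 ≤ R n k m)
    (hRrow : ∀ n, 0 < n → ∀ k, HasSum (R n k) 1)
    (hVoff : ∀ n k m, m ≠ k → 0 ≤ V n k m)
    (hVsum : ∀ n k, Summable (V n k))
    (hVrow : ∀ n k, ∑' m, V n k m = 0)
    (theta : K → ℝ) (hth0 : ∀ k, 0 ≤ theta k) (hthsum : Summable theta) :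
    ∀ (n : ℕ) (k : K),
      (∑' z : ℕ × K,
          ((∏ i ∈ Finset.range z.1, lam i / mu (i + 1)) * theta z.2) *
            qgen KW lam mu R V z (n, k) = 0)
        ↔ (∑' m : K, theta m * qred KW lam R V n m k = 0) := by
  intro n k
  set ξ : ℕ → ℝ := fun j => ∏ i ∈ Finset.range j, lam i / mu (i + 1) with hξ
  have hξpos : 0 < ξ n := Finset.prod_pos fun i _ => div_pos (hlam i) (hmu _ i.succ_pos)
  have hξsucc : ∀ j, ξ (j + 1) * mu (j + 1) = ξ j * lam j := fun j => by
    have := (hmu (j + 1) j.succ_pos).ne'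
    simp only [hξ, Finset.prod_range_succ]
    field_simp
  set r : K → ℝ := fun m =>
    ξ n * theta m * (if m ∈ KW then lam n * R (n + 1) m k else 0) with hr
  have hrsum : Summable r := by
    refine Summable.of_norm_bounded (hthsum.mul_left (ξ n * lam n)) fun m => ?_
    have hR0 := hRnn (n + 1) n.succ_pos m k
    have hR1 : R (n + 1) m k ≤ 1 :=
      le_hasSum (hRrow (n + 1) n.succ_pos m) k fun j _ => hRnn _ n.succ_pos m j
    have hc : 0 ≤ ξ n * lam n * theta m :=
      mul_nonneg (mul_nonneg hξpos.le (hlam n).le) (hth0 m)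
    simp only [hr]
    split_ifs
    · rw [Real.norm_of_nonneg (mul_nonneg (mul_nonneg hξpos.le (hth0 m))
        (mul_nonneg (hlam n).le hR0))]
      nlinarith
    · simpa using hc
  set c : ℝ := ξ n * theta k * (if k ∈ KW then mu n else 0) with hc
  have hzero : HasSum (fun z : ℕ × K =>
      ((if z.1 = n + 1 then r z.2 else 0) - (if z.1 = n then r z.2 else 0))
        + ((if z = (n - 1, k) then c else 0) - (if z = (n, k) then c else 0))) 0 := by
    have h := ((hrsum.hasSum.level (n + 1)).sub (hrsum.hasSum.level n)).add
      ((hasSum_ite_eq (n - 1, k) c).sub (hasSum_ite_eq (n, k) c))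
    simpa using h
  have key : ∑' z : ℕ × K, (ξ z.1 * theta z.2) * qgen KW lam mu R V z (n, k) =
      ξ n * ∑' m : K, theta m * qred KW lam R V n m k := by
    rw [← tsum_mul_left, ← tsum_level n fun m => ξ n * (theta m * qred KW lam R V n m k),
      ← tsum_add_of_hasSum_zero (fun z : ℕ × K =>
        if z.1 = n then ξ n * (theta z.2 * qred KW lam R V n z.2 k) else 0) hzero]
    refine tsum_congr ?_
    rintro ⟨i, m⟩
    by_cases hi : i = n
    · subst hi
      by_cases hm : m = k
      · subst hm
        have hexit := tsum_qoff KW lam mu R V hmu0 hRrow hVsum i m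
        rcases Nat.eq_zero_or_pos i with rfl | hpos
        · by_cases hk : m ∈ KW <;>
            simp [qgen, qred, hexit, hr, hc, hmu0, hk] <;> ring
        · have hne : i ≠ i - 1 := by omega
          by_cases hk : m ∈ KW <;>
            simp [qgen, qred, hexit, hr, hc, hk, hne] <;> ring
      · have hm' : k ≠ m := Ne.symm hm
        by_cases hk : m ∈ KW <;> simp [qgen, qoff, qred, hr, hk, hm, hm'] <;> ring
    by_cases hi1 : i = n + 1
    · subst hi1
      have hne : n + 1 ≠ n - 1 := by omega
      have hne' : n ≠ n + 1 + 1 := by omega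
      have hs := hξsucc n
      by_cases hk : m ∈ KW
      · simp [qgen, qoff, hr, hne, hne', hk]
        linear_combination theta m * R (n + 1) m k * hs
      · simp [qgen, qoff, hr, hne, hne', hk]
    by_cases hz : i + 1 = n ∧ m = k
    · obtain ⟨rfl, rfl⟩ := hz
      have hs := hξsucc i
      by_cases hk : m ∈ KW
      · simp [qgen, qoff, hc, hk, hi1]
        linear_combination -theta m * hs
      · simp [qgen, qoff, hc, hk, hi1]
    · have hq : qgen KW lam mu R V (i, m) (n, k) = 0 := by
        simp only [qgen, qoff, Prod.mk.injEq]
        grind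
      have hlow : (if ((i, m) : ℕ × K) = (n - 1, k) then c else 0) = 0 := by
        simp only [Prod.mk.injEq]
        grind
      simp only [hq, hi, hi1, hlow]
      simp [hi]
  rw [key]
  simp [hξpos.ne']
end
end

section
/- Consider the queueing-inventory generator with base stock level b ≥ 1, constant arrival rate λ > 0, replenishment rate ν > 0 and service rates μ(n) > 0. If C := ∑_{n=0}^∞ ∏_{i=0}^{n−1} λ/μ(i+1) < ∞, then π : E → ℝ defined by π(n,k) = C^{−1}·C_θ^{−1}·(∏_{i=0}^{n−1} λ/μ(i+1))·(ν/λ)^k, where C_θ = ∑_{k=0}^{b} (ν/λ)^k, is nonnegative, sums to 1 over E, and satisfies the global balance equations ∑_{z∈E} π(z)·q(z;z̃) = 0 for every z̃ ∈ E. (Product form of Example 3.1) -/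
open scoped Classical

noncomputable section

/-- The queueing-inventory generator with base stock level `b` on `E = ℕ × {0,…,b}`:
arrivals `(n,k) → (n+1,k)` at rate `λ·1{1 ≤ k}`, service `(n,k) → (n−1,k−1)` at rate
`μ(n)·1{n>0}·1{1 ≤ k}`, replenishments `(n,k) → (n,k+1)` at rate `ν·1{k ≤ b−1}`, and
conservative diagonal. -/
def qQI (b : ℕ) (lam nu : ℝ) (mu : ℕ → ℝ) :
    (ℕ × Fin (b + 1)) → (ℕ × Fin (b + 1)) → ℝ := fun z z' =>
  if z' = z then
    -((if 1 ≤ z.2.val then lam else 0)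
      + (if 0 < z.1 ∧ 1 ≤ z.2.val then mu z.1 else 0)
      + (if z.2.val < b then nu else 0))
  else if z'.1 = z.1 + 1 ∧ z'.2 = z.2 ∧ 1 ≤ z.2.val then lam
  else if z'.1 + 1 = z.1 ∧ z'.2.val + 1 = z.2.val then mu z.1
  else if z'.1 = z.1 ∧ z'.2.val = z.2.val + 1 then nu
  else 0

/-- The generator splits into its diagonal, arrival, service and replenishment parts. -/
theorem qQI_eq_add (b : ℕ) (lam nu : ℝ) (mu : ℕ → ℝ) (z z' : ℕ × Fin (b + 1)) :
    qQI b lam nu mu z z' =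
      (if z' = z then
        -((if 1 ≤ z.2.val then lam else 0)
          + (if 0 < z.1 ∧ 1 ≤ z.2.val then mu z.1 else 0)
          + (if z.2.val < b then nu else 0)) else 0)
      + (if z'.1 = z.1 + 1 ∧ z'.2 = z.2 ∧ 1 ≤ z.2.val then lam else 0)
      + (if z'.1 + 1 = z.1 ∧ z'.2.val + 1 = z.2.val then mu z.1 else 0)
      + (if z'.1 = z.1 ∧ z'.2.val = z.2.val + 1 then nu else 0) := by
  obtain ⟨n, k⟩ := z
  obtain ⟨m, j⟩ := z'
  unfold qQI
  by_cases h₁ : (m, j) = (n, k)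
  · obtain ⟨rfl, rfl⟩ := Prod.mk.inj h₁
    simp
  by_cases h₂ : m = n + 1 ∧ j = k ∧ 1 ≤ k.val
  · obtain ⟨rfl, rfl, h⟩ := h₂
    simp [h]
  by_cases h₃ : m + 1 = n ∧ j.val + 1 = k.val
  · have h₄ : ¬ (m = n ∧ j.val = k.val + 1) := by omega
    simp only [if_neg h₁, if_neg h₂, if_pos h₃, if_neg h₄]
    ring
  · simp only [if_neg h₁, if_neg h₂, if_neg h₃]
    ring

variable {b : ℕ} {lam nu r : ℝ} {mu w : ℕ → ℝ}

theorem hasSum_diagonal (f d : ℕ × Fin (b + 1) → ℝ) (z' : ℕ × Fin (b + 1)) :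
    HasSum (fun z => f z * if z' = z then d z else 0) (f z' * d z') := by
  convert hasSum_single z' _ using 1
  · simp
  · intro z hz
    simp [hz.symm]

/-- The arrival inflow into `(m, j)` balances the service outflow. -/
theorem hasSum_arrival (hw : ∀ n, mu (n + 1) * w (n + 1) = lam * w n) (z' : ℕ × Fin (b + 1)) :
    HasSum (fun z : ℕ × Fin (b + 1) => (w z.1 * r ^ z.2.val) *
        if z'.1 = z.1 + 1 ∧ z'.2 = z.2 ∧ 1 ≤ z.2.val then lam else 0)
      (w z'.1 * r ^ z'.2.val * if 0 < z'.1 ∧ 1 ≤ z'.2.val then mu z'.1 else 0) := by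
  obtain ⟨m, j⟩ := z'
  by_cases h : 0 < m ∧ 1 ≤ j.val
  · obtain ⟨n, rfl⟩ := Nat.exists_eq_add_of_lt h.1
    rw [Nat.zero_add] at *
    convert hasSum_single (n, j) _ using 1
    · simp only [if_pos h, true_and, if_pos h.2]
      linear_combination r ^ j.val * hw n
    · rintro ⟨m, k⟩ hne
      rw [if_neg, mul_zero]
      rintro ⟨h₁, rfl, -⟩
      exact hne (by simpa using h₁.symm)
  · convert hasSum_zero using 1
    · funext ⟨n, k⟩
      rw [if_neg, mul_zero]
      rintro ⟨h₁, rfl, h₃⟩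
      exact h ⟨by simp only at h₁; omega, h₃⟩
    · simp [h]

/-- The service inflow into `(m, j)` balances the replenishment outflow. -/
theorem hasSum_service (hw : ∀ n, mu (n + 1) * w (n + 1) = lam * w n) (hr : lam * r = nu)
    (z' : ℕ × Fin (b + 1)) :
    HasSum (fun z : ℕ × Fin (b + 1) => (w z.1 * r ^ z.2.val) *
        if z'.1 + 1 = z.1 ∧ z'.2.val + 1 = z.2.val then mu z.1 else 0)
      (w z'.1 * r ^ z'.2.val * if z'.2.val < b then nu else 0) := by
  obtain ⟨m, j⟩ := z'
  by_cases h : j.val < b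
  · convert hasSum_single ((m + 1, ⟨j.val + 1, by omega⟩) : ℕ × Fin (b + 1)) _ using 1
    · simp only [if_pos h, and_self, if_true]
      linear_combination -w m * r ^ j.val * hr - r ^ (j.val + 1) * hw m
    · rintro ⟨n, k⟩ hne
      rw [if_neg, mul_zero]
      rintro ⟨h₁, h₂⟩
      exact hne (Prod.ext h₁.symm (Fin.ext h₂.symm))
  · convert hasSum_zero using 1
    · funext ⟨n, k⟩
      rw [if_neg, mul_zero]
      rintro ⟨-, h₂⟩
      have := k.isLt
      simp only at h₂
      omega
    · simp [h]

/-- The replenishment inflow into `(m, j)` balances the arrival outflow. -/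
theorem hasSum_replenishment (hr : lam * r = nu) (z' : ℕ × Fin (b + 1)) :
    HasSum (fun z : ℕ × Fin (b + 1) => (w z.1 * r ^ z.2.val) *
        if z'.1 = z.1 ∧ z'.2.val = z.2.val + 1 then nu else 0)
      (w z'.1 * r ^ z'.2.val * if 1 ≤ z'.2.val then lam else 0) := by
  obtain ⟨m, j⟩ := z'
  by_cases h : 1 ≤ j.val
  · have hj : j.val = j.val - 1 + 1 := by omega
    convert hasSum_single ((m, ⟨j.val - 1, by omega⟩) : ℕ × Fin (b + 1)) _ using 1
    · simp only [if_pos h, true_and, if_pos hj]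
      rw [hj, pow_succ, Nat.add_sub_cancel]
      linear_combination w m * r ^ (j.val - 1) * hr
    · rintro ⟨n, k⟩ hne
      rw [if_neg, mul_zero]
      rintro ⟨h₁, h₂⟩
      exact hne (Prod.ext h₁.symm (Fin.ext (by simp only at h₂ ⊢; omega)))
  · convert hasSum_zero using 1
    · funext ⟨n, k⟩
      rw [if_neg, mul_zero]
      rintro ⟨-, h₂⟩
      simp only at h₂
      omega
    · simp [h]

/-- Product weights satisfying detailed recursions in both coordinates solve the global balance
equations. -/
theorem hasSum_mul_qQI (hw : ∀ n, mu (n + 1) * w (n + 1) = lam * w n) (hr : lam * r = nu)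
    (z' : ℕ × Fin (b + 1)) :
    HasSum (fun z : ℕ × Fin (b + 1) => w z.1 * r ^ z.2.val * qQI b lam nu mu z z') 0 := by
  convert (((hasSum_diagonal (fun z : ℕ × Fin (b + 1) => w z.1 * r ^ z.2.val)
    (fun z => -((if 1 ≤ z.2.val then lam else 0)
      + (if 0 < z.1 ∧ 1 ≤ z.2.val then mu z.1 else 0)
      + (if z.2.val < b then nu else 0))) z').add
    (hasSum_arrival hw z')).add (hasSum_service hw hr z')).add (hasSum_replenishment hr z') using 1
  · funext z
    rw [qQI_eq_add]
    ring
  · ring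

theorem hasSum_product_weight (hw : Summable w) (hw0 : ∀ n, 0 ≤ w n) (hr : 0 ≤ r) :
    HasSum (fun z : ℕ × Fin (b + 1) => w z.1 * r ^ z.2.val)
      ((∑' n, w n) * ∑ k ∈ Finset.range (b + 1), r ^ k) := by
  have hk : HasSum (fun k : Fin (b + 1) => r ^ k.val) (∑ k ∈ Finset.range (b + 1), r ^ k) := by
    rw [← Fin.sum_univ_eq_sum_range (fun k => r ^ k)]
    exact hasSum_fintype _
  have hr' : 0 ≤ fun k : Fin (b + 1) => r ^ k.val := fun k => pow_nonneg hr _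
  have hs := Summable.mul_of_nonneg hw hk.summable hw0 hr'
  exact hw.hasSum.mul hk hs

/-- Product form of Example 3.1: the queueing-inventory system with base stock policy has
the product-form stationary distribution
`π(n,k) = C⁻¹·C_θ⁻¹·(∏_{i<n} λ/μ(i+1))·(ν/λ)^k`. -/
theorem queueing_inventory_product_form
    (b : ℕ) (hb : 1 ≤ b) (lam nu : ℝ) (mu : ℕ → ℝ)
    (hlam : 0 < lam) (hnu : 0 < nu) (hmu : ∀ n, 0 < n → 0 < mu n)
    (hC : Summable (fun n : ℕ => ∏ i ∈ Finset.range n, lam / mu (i + 1))) :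
    (∀ z : ℕ × Fin (b + 1), 0 ≤
        (∑' n : ℕ, ∏ i ∈ Finset.range n, lam / mu (i + 1))⁻¹ *
          (∑ k ∈ Finset.range (b + 1), (nu / lam) ^ k)⁻¹ *
          (∏ i ∈ Finset.range z.1, lam / mu (i + 1)) * (nu / lam) ^ z.2.val) ∧
    (∑' z : ℕ × Fin (b + 1),
        (∑' n : ℕ, ∏ i ∈ Finset.range n, lam / mu (i + 1))⁻¹ *
          (∑ k ∈ Finset.range (b + 1), (nu / lam) ^ k)⁻¹ *
          (∏ i ∈ Finset.range z.1, lam / mu (i + 1)) * (nu / lam) ^ z.2.val) = 1 ∧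
    (∀ z' : ℕ × Fin (b + 1),
      ∑' z : ℕ × Fin (b + 1),
        ((∑' n : ℕ, ∏ i ∈ Finset.range n, lam / mu (i + 1))⁻¹ *
          (∑ k ∈ Finset.range (b + 1), (nu / lam) ^ k)⁻¹ *
          (∏ i ∈ Finset.range z.1, lam / mu (i + 1)) * (nu / lam) ^ z.2.val) *
          qQI b lam nu mu z z' = 0) := by
  set w : ℕ → ℝ := fun n => ∏ i ∈ Finset.range n, lam / mu (i + 1) with hw_def
  have hwpos : ∀ n, 0 < w n := fun n =>
    Finset.prod_pos fun i _ => div_pos hlam (hmu _ i.succ_pos)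
  have hr : 0 < nu / lam := div_pos hnu hlam
  have hC_pos : 0 < ∑' n, w n := hC.tsum_pos (fun n => (hwpos n).le) 0 (hwpos 0)
  have hCθ_pos : 0 < ∑ k ∈ Finset.range (b + 1), (nu / lam) ^ k :=
    Finset.sum_pos (fun k _ => pow_pos hr k) ⟨0, by simp⟩
  have hw : ∀ n, mu (n + 1) * w (n + 1) = lam * w n := fun n => by
    have := (hmu (n + 1) n.succ_pos).ne'
    simp only [hw_def, Finset.prod_range_succ]
    field_simp
  refine ⟨fun z => ?_, ?_, fun z' => ?_⟩
  · have := hwpos z.1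
    change 0 ≤ (∑' n, w n)⁻¹ * _ * w z.1 * _
    positivity
  · convert ((hasSum_product_weight (b := b) hC (fun n => (hwpos n).le) hr.le).mul_left
      ((∑' n, w n)⁻¹ * (∑ k ∈ Finset.range (b + 1), (nu / lam) ^ k)⁻¹)).tsum_eq using 1
    · exact tsum_congr fun z => by simp only [hw_def]; ring
    · field_simp
  · convert ((hasSum_mul_qQI hw (mul_div_cancel₀ nu hlam.ne') z').mul_left
      ((∑' n, w n)⁻¹ * (∑ k ∈ Finset.range (b + 1), (nu / lam) ^ k)⁻¹)).tsum_eq using 1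
    · exact tsum_congr fun z => by simp only [hw_def]; ring
    · ring
end
end

section
/- Consider the perishable queueing-inventory generator with base stock level b = 1 and rates λ, μ, ν, γ > 0 with λ < μ. Define π : ℕ × {0,1} → ℝ by π(0,0) = C^{−1}·(λ+γ)/ν, π(n,0) = C^{−1}·(λ/μ)^n·(λ/ν) for n > 0, and π(n,1) = C^{−1}·(λ/μ)^n for n ≥ 0, where C = (μ/(μ−λ))·(1 + λ/ν) + γ/ν. Then π is nonnegative, ∑_{(n,k)} π(n,k) = 1, and π satisfies the global balance equations ∑_{z∈E} π(z)·q(z;z̃) = 0 for every z̃ ∈ E. (Corollary 4.2) -/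
open scoped Classical

noncomputable section

/-- Perishable queueing-inventory generator with base stock level `b = 1` on `E = ℕ × {0,1}`:
`q((n,1);(n+1,1)) = λ`, `q((n,1);(n−1,0)) = μ·1{n>0}`, `q((0,1);(0,0)) = γ`,
`q((n,0);(n,1)) = ν`, with conservative diagonal. -/
def qPer (lam mu nu gam : ℝ) : (ℕ × Fin 2) → (ℕ × Fin 2) → ℝ := fun z z' =>
  if z' = z then
    if z.2 = (1 : Fin 2) then
      -(lam + (if 0 < z.1 then mu else gam))
    else -nu
  else if z.2 = (1 : Fin 2) ∧ z'.1 = z.1 + 1 ∧ z'.2 = (1 : Fin 2) then lam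
  else if z.2 = (1 : Fin 2) ∧ z'.1 + 1 = z.1 ∧ z'.2 = (0 : Fin 2) then mu
  else if z = ((0 : ℕ), (1 : Fin 2)) ∧ z' = ((0 : ℕ), (0 : Fin 2)) then gam
  else if z.2 = (0 : Fin 2) ∧ z'.1 = z.1 ∧ z'.2 = (1 : Fin 2) then nu
  else 0

/-- The stationary distribution of Corollary 4.2:
`π(0,0) = C⁻¹·(λ+γ)/ν`, `π(n,0) = C⁻¹·(λ/μ)^n·(λ/ν)` for `n > 0`,
`π(n,1) = C⁻¹·(λ/μ)^n`, where `C = (μ/(μ−λ))·(1 + λ/ν) + γ/ν`. -/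
def piPer (lam mu nu gam : ℝ) : (ℕ × Fin 2) → ℝ := fun z =>
  if z.2 = (1 : Fin 2) then
    ((mu / (mu - lam)) * (1 + lam / nu) + gam / nu)⁻¹ * (lam / mu) ^ z.1
  else if z.1 = 0 then
    ((mu / (mu - lam)) * (1 + lam / nu) + gam / nu)⁻¹ * ((lam + gam) / nu)
  else
    ((mu / (mu - lam)) * (1 + lam / nu) + gam / nu)⁻¹ * (lam / mu) ^ z.1 * (lam / nu)

/-- The unnormalized weights: a product form plus a correction at `(0, 0)`. -/
theorem piPer_eq (lam mu nu gam : ℝ) (z : ℕ × Fin 2) :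
    piPer lam mu nu gam z =
      ((mu / (mu - lam)) * (1 + lam / nu) + gam / nu)⁻¹ *
        ((lam / mu) ^ z.1 * (if z.2 = 1 then 1 else lam / nu) +
          if z = (0, 0) then gam / nu else 0) := by
  obtain ⟨n, k⟩ := z
  fin_cases k
  · rcases n with _ | n
    · simp [piPer]
      left
      ring
    · simp [piPer]
      ring
  · simp [piPer]

theorem HasSum.mul_of_nonneg {ι κ : Type*} {f : ι → ℝ} {g : κ → ℝ} {a b : ℝ}
    (hf : HasSum f a) (hg : HasSum g b) (hf_nonneg : 0 ≤ f) (hg_nonneg : 0 ≤ g) :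
    HasSum (fun x : ι × κ => f x.1 * g x.2) (a * b) :=
  hf.mul hg (hf.summable.mul_of_nonneg hg.summable hf_nonneg hg_nonneg)

theorem hasSum_piPer {lam mu nu gam : ℝ} (hlam : 0 < lam) (hmu : 0 < mu) (hnu : 0 < nu)
    (hgam : 0 < gam) (hstab : lam < mu) : HasSum (piPer lam mu nu gam) 1 := by
  have hd : 0 < mu - lam := sub_pos.mpr hstab
  have hgeom : HasSum (fun n : ℕ => (lam / mu) ^ n) (mu / (mu - lam)) := by
    have h := hasSum_geometric_of_lt_one (div_nonneg hlam.le hmu.le)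
      ((div_lt_one hmu).mpr hstab)
    rwa [one_sub_div hmu.ne', inv_div] at h
  have hweight : HasSum (fun k : Fin 2 => if k = 1 then (1 : ℝ) else lam / nu)
      (1 + lam / nu) := by
    have h := hasSum_fintype (fun k : Fin 2 => if k = 1 then (1 : ℝ) else lam / nu)
    rwa [Fin.sum_univ_two, if_neg zero_ne_one, if_pos rfl, add_comm] at h
  have hgeom_nonneg : 0 ≤ fun n : ℕ => (lam / mu) ^ n := fun n => by
    dsimp only [Pi.zero_apply]
    positivity
  have hweight_nonneg : 0 ≤ fun k : Fin 2 => if k = 1 then (1 : ℝ) else lam / nu := fun k => by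
    dsimp only [Pi.zero_apply]
    split_ifs <;> positivity
  have hprod := hgeom.mul_of_nonneg hweight hgeom_nonneg hweight_nonneg
  have hC : (mu / (mu - lam)) * (1 + lam / nu) + gam / nu ≠ 0 := by positivity
  have h := (hprod.add (hasSum_ite_eq ((0, 0) : ℕ × Fin 2) (gam / nu))).mul_left
    ((mu / (mu - lam)) * (1 + lam / nu) + gam / nu)⁻¹
  rw [inv_mul_cancel₀ hC] at h
  rw [funext (piPer_eq lam mu nu gam)]
  exact h

theorem tsum_piPer_mul_qPer {lam mu nu : ℝ} (gam : ℝ) (hmu : mu ≠ 0) (hnu : nu ≠ 0)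
    (z' : ℕ × Fin 2) :
    ∑' z : ℕ × Fin 2, piPer lam mu nu gam z * qPer lam mu nu gam z z' = 0 := by
  obtain ⟨n, k⟩ := z'
  fin_cases k
  · rcases n with _ | n
    · rw [tsum_eq_sum (s := {(0, 0), (0, 1), (1, 1)})]
      · simp [piPer, qPer]
        field_simp
        ring
      · rintro ⟨m, j⟩ h
        fin_cases j <;> simp [qPer] at h ⊢ <;> grind
    · rw [tsum_eq_sum (s := {(n + 1, 0), (n + 2, 1)})]
      · simp [piPer, qPer, pow_succ]
        generalize (mu / (mu - lam) * (1 + lam / nu) + gam / nu)⁻¹ = c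
        generalize (lam / mu) ^ n = p
        field_simp
        ring
      · rintro ⟨m, j⟩ h
        fin_cases j <;> simp [qPer] at h ⊢ <;> grind
  · rcases n with _ | n
    · rw [tsum_eq_sum (s := {(0, 0), (0, 1)})]
      · simp [piPer, qPer]
        field_simp
        ring
      · rintro ⟨m, j⟩ h
        fin_cases j <;> simp [qPer] at h ⊢ <;> grind
    · rw [tsum_eq_sum (s := {(n, 1), (n + 1, 1), (n + 1, 0)})]
      · simp [piPer, qPer, pow_succ]
        generalize (mu / (mu - lam) * (1 + lam / nu) + gam / nu)⁻¹ = c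
        generalize (lam / mu) ^ n = p
        field_simp
        ring
      · rintro ⟨m, j⟩ h
        fin_cases j <;> simp [qPer] at h ⊢ <;> grind

/-- Corollary 4.2: for `b = 1` and `λ < μ`, `π` is a probability distribution solving the
global balance equations of the perishable queueing-inventory generator. -/
theorem perishable_b1_stationary
    (lam mu nu gam : ℝ)
    (hlam : 0 < lam) (hmu : 0 < mu) (hnu : 0 < nu) (hgam : 0 < gam)
    (hstab : lam < mu) :
    (∀ z : ℕ × Fin 2, 0 ≤ piPer lam mu nu gam z) ∧
    (∑' z : ℕ × Fin 2, piPer lam mu nu gam z) = 1 ∧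
    (∀ z' : ℕ × Fin 2,
      ∑' z : ℕ × Fin 2, piPer lam mu nu gam z * qPer lam mu nu gam z z' = 0) := by
  have hd : 0 < mu - lam := sub_pos.mpr hstab
  refine ⟨fun z => ?_, (hasSum_piPer hlam hmu hnu hgam hstab).tsum_eq,
    tsum_piPer_mul_qPer gam hmu.ne' hnu.ne'⟩
  unfold piPer
  split_ifs <;> positivity
end
end

section
/- Assume K is finite, K_B ≠ ∅, K_W ≠ ∅, and the generator Q is irreducible on E, i.e. for all z, z̃ ∈ E with z ≠ z̃ there is a finite sequence z = z_0, z_1, …, z_m = z̃ in E with q(z_i; z_{i+1}) > 0 for all i. Then for every n ∈ ℕ there exist k ∈ K_W and ℓ ∈ K_B such that R_{n+1}(k,ℓ) > 0 or v_n(k,ℓ) > 0; consequently, if τ_n : K → ℝ satisfies τ_n(ℓ) > 0 for all ℓ ∈ K_B and τ_n(ℓ) = 0 for all ℓ ∈ K_W, then max( max_{k∈K_W} μ(n+1)·∑_{ℓ∈K_B} R_{n+1}(k,ℓ)·τ_n(ℓ), max_{k∈K_W} ∑_{ℓ∈K_B} v_n(k,ℓ)·τ_n(ℓ) ) > 0.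 (Lemma 4.7: the constants ĉ_n are well-defined, i.e. finite) -/
open scoped Classical

noncomputable section

/-- A set of states that no single transition can leave is not left by any path. -/
theorem transGen_invariant {α : Type*} {r : α → α → Prop} {p : α → Prop}
    (hp : ∀ a b, r a b → p a → p b) {a b : α} (h : Relation.TransGen r a b) (ha : p a) : p b := by
  induction h with
  | single hab => exact hp _ _ hab ha
  | tail _ hbc ih => exact hp _ _ hbc ih

/-- A direct transition of the queueing-environment process that enters level `n` with
environment outside `KW` starts there as well, or is one of the two kinds of transition
from `KW` into `KWᶜ`. -/
theorem qgen_pos_into_blocked {K : Type*} {KW : Set K} {lam mu : ℕ → ℝ} {R V : ℕ → K → K → ℝ}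
    (hmu : ∀ n, 0 < n → 0 < mu n) {z z' : ℕ × K} (hq : 0 < qgen KW lam mu R V z z')
    (hz' : z'.2 ∉ KW) :
    (z.1 = z'.1 ∧ z.2 ∉ KW) ∨
      (z.2 ∈ KW ∧ (0 < R (z'.1 + 1) z.2 z'.2 ∨ 0 < V z'.1 z.2 z'.2)) := by
  by_cases hz : z.2 ∈ KW
  · refine Or.inr ⟨hz, ?_⟩
    simp only [qgen, qoff, hz, if_true] at hq
    split_ifs at hq with h1 h2 h3 h4
    · exact absurd (h1 ▸ hz) hz'
    · exact absurd (h2.2 ▸ hz) hz'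
    · rw [h3]
      exact Or.inl ((pos_iff_pos_of_mul_pos hq).1 (hmu _ (by omega)))
    · exact Or.inr (h4 ▸ hq)
    · exact absurd hq (lt_irrefl 0)
  · refine Or.inl ⟨?_, hz⟩
    simp only [qgen, qoff, hz, if_false] at hq
    split_ifs at hq with h1 h2 h3 h4
    · rw [h1]
    · exact absurd hq (lt_irrefl 0)
    · exact absurd hq (lt_irrefl 0)
    · exact h4.symm
    · exact absurd hq (lt_irrefl 0)

/-- A weighted row sum over `KWᶜ`, with rates that are nonnegative there, is positive as soon
as one of the rates is. -/
theorem sum_compl_rate_mul_pos {K : Type*} [Fintype K] {KW : Set K} {f tau : K → ℝ}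
    (hf : ∀ m ∈ KWᶜ, 0 ≤ f m) (htau : ∀ m ∈ KWᶜ, 0 < tau m) {l : K} (hl : l ∈ KWᶜ)
    (hfl : 0 < f l) : 0 < ∑ m : K, (if m ∈ KWᶜ then f m * tau m else 0) := by
  refine Finset.sum_pos' (fun m _ => ?_) ⟨l, Finset.mem_univ l, ?_⟩
  · split_ifs with hm
    · exact mul_nonneg (hf m hm) (htau m hm).le
    · exact le_rfl
  · rw [if_pos hl]
    exact mul_pos hfl (htau l hl)

/-- The supremum of a real function over a subset of a finite type is positive if one of its
values is. -/
theorem sSup_image_pos {K : Type*} [Finite K] {s : Set K} {f : K → ℝ} {k : K} (hk : k ∈ s)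
    (hfk : 0 < f k) : 0 < sSup (f '' s) :=
  hfk.trans_le (le_csSup (s.toFinite.image f).bddAbove (Set.mem_image_of_mem f hk))

/-- Lemma 4.7: if `K` is finite, `K_W` and `K_B = K_Wᶜ` are nonempty, and `Q` is
irreducible on `E` (any two distinct states are connected by a finite path of positive
rates), then for every `n` some transition from `K_W` into `K_B` has positive rate
(via `R_{n+1}` or `V_n`); consequently, for any `τ_n` positive on `K_B` and zero on
`K_W`, the maximum appearing in the definition of `ĉ_n` is positive, so `ĉ_n < ∞`. -/
theorem chat_well_defined
    {K : Type*} [Fintype K] [Nonempty K]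
    (KW : Set K) (hKW : KW.Nonempty) (hKB : KWᶜ.Nonempty)
    (lam mu : ℕ → ℝ) (R V : ℕ → K → K → ℝ)
    (hlam : ∀ n, 0 < lam n)
    (hmu0 : mu 0 = 0) (hmu : ∀ n, 0 < n → 0 < mu n)
    (hRnn : ∀ n, 0 < n → ∀ k m, 0 ≤ R n k m)
    (hRrow : ∀ n, 0 < n → ∀ k, ∑ m : K, R n k m = 1)
    (hVoff : ∀ n k m, m ≠ k → 0 ≤ V n k m)
    (hVrow : ∀ n k, ∑ m : K, V n k m = 0)
    (hirr : ∀ z z' : ℕ × K, z ≠ z' →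
      Relation.TransGen (fun a b => 0 < qgen KW lam mu R V a b) z z') :
    ∀ n : ℕ,
      (∃ k ∈ KW, ∃ l ∈ KWᶜ, 0 < R (n + 1) k l ∨ 0 < V n k l) ∧
      (∀ tau : K → ℝ, (∀ l ∈ KWᶜ, 0 < tau l) → (∀ l ∈ KW, tau l = 0) →
        0 < max
          (sSup ((fun k =>
            mu (n + 1) * ∑ l : K, (if l ∈ KWᶜ then R (n + 1) k l * tau l else 0)) '' KW))
          (sSup ((fun k =>
            ∑ l : K, (if l ∈ KWᶜ then V n k l * tau l else 0)) '' KW))) := by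
  intro n
  have hex : ∃ k ∈ KW, ∃ l ∈ KWᶜ, 0 < R (n + 1) k l ∨ 0 < V n k l := by
    by_contra hno
    obtain ⟨w, hw⟩ := hKW
    obtain ⟨b, hb⟩ := hKB
    have hne : ((n, w) : ℕ × K) ≠ (n, b) := by
      rintro ⟨⟩
      exact hb hw
    refine transGen_invariant (p := fun z : ℕ × K => ¬(z.1 = n ∧ z.2 ∉ KW)) ?_
      (hirr _ _ hne) (fun h => h.2 hw) ⟨rfl, hb⟩
    rintro z z' hq hz ⟨rfl, hz'⟩
    rcases qgen_pos_into_blocked hmu hq hz' with h | ⟨hk, h⟩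
    · exact hz h
    · exact hno ⟨z.2, hk, z'.2, hz', h⟩
  refine ⟨hex, fun tau htau _ => ?_⟩
  obtain ⟨k, hk, l, hl, h | h⟩ := hex
  · exact lt_max_of_lt_left (sSup_image_pos hk (mul_pos (hmu _ n.succ_pos)
      (sum_compl_rate_mul_pos (fun m _ => hRnn _ n.succ_pos k m) htau hl h)))
  · exact lt_max_of_lt_right (sSup_image_pos hk
      (sum_compl_rate_mul_pos (fun m hm => hVoff n k m fun e => hm (e ▸ hk)) htau hl h))
end
end

section
/- Assume K is finite. Let L̃ : ℕ → ℝ≥0, F̃ ⊆ ℕ finite, ε̃ > 0 satisfy: λ(0)·(L̃(1) − L̃(0)) ≤ −ε̃ if 0 ∉ F̃, and λ(n)·(L̃(n+1) − L̃(n)) + μ(n)·(L̃(n−1) − L̃(n)) ≤ −ε̃ for all n ∉ F̃ with n > 0. For each n ∈ ℕ let τ_n : K → ℝ satisfy τ_n = 0 on K_W, τ_n > 0 on K_B, and the first-entrance equations. Let c : ℕ → ℝ satisfy c_* := inf_{n∈ℕ} c_n > 0 and, for every n ∈ ℕ and every k ∈ K_W: c_n·μ(n+1)·∑_{ℓ∈K_B}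 R_{n+1}(k,ℓ)·τ_n(ℓ) ≤ ε̃/4 and c_n·∑_{ℓ∈K_B} v_n(k,ℓ)·τ_n(ℓ) ≤ ε̃/4. Define L : E → ℝ≥0 by L(n,k) = L̃(n) + 1{k∈K_B}·c_n·τ_n(k) and ε = min(ε̃/2, c_*). Then (QL)(n,k) := ∑_{z̃∈E} q((n,k); z̃)·L(z̃) ≤ −ε for every (n,k) ∈ E with n ∉ F̃. (Drift inequality of Theorem 4.8) -/
open scoped Classical

noncomputable section

theorem qoff_self {K : Type*} (KW : Set K) (lam mu : ℕ → ℝ) (R V : ℕ → K → K → ℝ)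
    (z : ℕ × K) : qoff KW lam mu R V z z = 0 := by
  simp [qoff]

theorem qoff_up {K : Type*} (KW : Set K) (lam mu : ℕ → ℝ) (R V : ℕ → K → K → ℝ)
    (n : ℕ) (k l : K) :
    qoff KW lam mu R V (n, k) (n + 1, l) = if l = k then (if k ∈ KW then lam n else 0) else 0 := by
  have h : n + 1 + 1 ≠ n := by omega
  simp [qoff, h]

theorem qoff_level {K : Type*} (KW : Set K) (lam mu : ℕ → ℝ) (R V : ℕ → K → K → ℝ)
    (n : ℕ) (k l : K) :
    qoff KW lam mu R V (n, k) (n, l) = if l = k then 0 else V n k l := by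
  simp [qoff]

theorem qoff_down {K : Type*} (KW : Set K) (lam mu : ℕ → ℝ) (R V : ℕ → K → K → ℝ)
    (n : ℕ) (k l : K) :
    qoff KW lam mu R V (n + 1, k) (n, l) =
      if k ∈ KW then mu (n + 1) * R (n + 1) k l else 0 := by
  have h : n ≠ n + 1 + 1 := by omega
  simp [qoff, h]

theorem qoff_eq_zero {K : Type*} (KW : Set K) (lam mu : ℕ → ℝ) (R V : ℕ → K → K → ℝ)
    {n m : ℕ} (k l : K) (h₁ : m ≠ n + 1) (h₂ : m + 1 ≠ n) (h₃ : m ≠ n) :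
    qoff KW lam mu R V (n, k) (m, l) = 0 := by
  simp [qoff, h₁, h₂, h₃]

theorem qoff_eq_zero_of_notMem {K : Type*} [Fintype K] (KW : Set K) (lam mu : ℕ → ℝ)
    (R V : ℕ → K → K → ℝ) (n : ℕ) (k : K) {z : ℕ × K}
    (hz : z ∉ Finset.range (n + 2) ×ˢ (Finset.univ : Finset K)) :
    qoff KW lam mu R V (n, k) z = 0 := by
  have h : n + 2 ≤ z.1 := by simpa using hz
  exact qoff_eq_zero KW lam mu R V k z.2 (by omega) (by omega) (by omega)

/-- `(Q f)(z)` as a sum of jump rates times increments of `f`. -/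
theorem tsum_qgen_mul {K : Type*} [Fintype K] (KW : Set K) (lam mu : ℕ → ℝ)
    (R V : ℕ → K → K → ℝ) (n : ℕ) (k : K) (f : ℕ × K → ℝ) :
    ∑' z, qgen KW lam mu R V (n, k) z * f z =
      ∑ m ∈ Finset.range (n + 2), ∑ l : K,
        qoff KW lam mu R V (n, k) (m, l) * (f (m, l) - f (n, k)) := by
  set S := Finset.range (n + 2) ×ˢ (Finset.univ : Finset K) with hS
  have hmem : (n, k) ∈ S := by simp [hS]
  have hout : ∀ z ∉ S, qgen KW lam mu R V (n, k) z * f z = 0 := by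
    intro z hz
    have hne : z ≠ (n, k) := fun h => hz (h ▸ hmem)
    rw [qgen, if_neg hne, qoff_eq_zero_of_notMem KW lam mu R V n k hz, zero_mul]
  have hsplit : ∀ z, qgen KW lam mu R V (n, k) z * f z =
      qoff KW lam mu R V (n, k) z * f z +
        if z = (n, k) then -(∑ w ∈ S, qoff KW lam mu R V (n, k) w) * f (n, k) else 0 := by
    intro z
    by_cases h : z = (n, k)
    · subst h
      rw [qgen, if_pos rfl, if_pos rfl, qoff_self, zero_mul, zero_add,
        tsum_eq_sum fun w hw => qoff_eq_zero_of_notMem KW lam mu R V n k hw]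
    · rw [qgen, if_neg h, if_neg h, add_zero]
  rw [tsum_eq_sum hout, Finset.sum_congr rfl fun z _ => hsplit z, Finset.sum_add_distrib,
    Finset.sum_ite_eq' S, if_pos hmem, neg_mul, Finset.sum_mul, ← sub_eq_add_neg,
    ← Finset.sum_sub_distrib, hS, Finset.sum_product]
  simp only [mul_sub]

theorem tsum_qgen_mul_zero {K : Type*} [Fintype K] (KW : Set K) (lam mu : ℕ → ℝ)
    (R V : ℕ → K → K → ℝ) (k : K) (f : ℕ × K → ℝ) :
    ∑' z, qgen KW lam mu R V (0, k) z * f z =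
      (∑ l : K, V 0 k l * (f (0, l) - f (0, k))) +
        (if k ∈ KW then lam 0 else 0) * (f (1, k) - f (0, k)) := by
  rw [tsum_qgen_mul, Finset.sum_range_succ, Finset.sum_range_succ, Finset.sum_range_zero, zero_add]
  congr 1
  · refine Finset.sum_congr rfl fun l _ => ?_
    rw [qoff_level]
    split_ifs with h <;> simp [h]
  · simp [qoff_up, ite_mul]

theorem tsum_qgen_mul_succ {K : Type*} [Fintype K] (KW : Set K) (lam mu : ℕ → ℝ)
    (R V : ℕ → K → K → ℝ) (n : ℕ) (k : K) (f : ℕ × K → ℝ) :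
    ∑' z, qgen KW lam mu R V (n + 1, k) z * f z =
      (∑ l : K, (if k ∈ KW then mu (n + 1) * R (n + 1) k l else 0) *
          (f (n, l) - f (n + 1, k))) +
        (∑ l : K, V (n + 1) k l * (f (n + 1, l) - f (n + 1, k))) +
        (if k ∈ KW then lam (n + 1) else 0) * (f (n + 2, k) - f (n + 1, k)) := by
  rw [tsum_qgen_mul, Finset.sum_range_succ, Finset.sum_range_succ, Finset.sum_range_succ,
    Finset.sum_eq_zero, zero_add]
  · congr 1
    · congr 1
      · simp only [qoff_down]
      · refine Finset.sum_congr rfl fun l _ => ?_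
        rw [qoff_level]
        split_ifs with h <;> simp [h]
    · simp [qoff_up, ite_mul]
  · intro m hm
    have hm' := Finset.mem_range.mp hm
    refine Finset.sum_eq_zero fun l _ => ?_
    rw [qoff_eq_zero KW lam mu R V k l (by omega) (by omega) (by omega), zero_mul]

/-- The first-entrance equation as a single sum over the environment. -/
theorem sum_mul_sub_eq_neg_one_of_firstEntrance {K : Type*} [Fintype K] (KW : Set K)
    (v : K → K → ℝ) (t : K → ℝ) (htW : ∀ l ∈ KW, t l = 0) (k : K)
    (hFE : (-1 : ℝ) = (∑ l : K, if l ∈ KWᶜ ∧ l ≠ k then v k l * (t l - t k) else 0)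
        - (∑ l : K, if l ∈ KW then v k l * t k else 0)) :
    ∑ l : K, v k l * (t l - t k) = -1 := by
  rw [hFE, ← Finset.sum_sub_distrib]
  refine Finset.sum_congr rfl fun l _ => ?_
  by_cases hl : l ∈ KW
  · simp [hl, htW l hl]
  · rcases eq_or_ne l k with rfl | hlk
    · simp [hl]
    · simp [hl, hlk]

/-- Drift inequality of Theorem 4.8: given a Lyapunov function `L̃` for the birth-death
part, first-entrance-time functions `τ_n` and constants `c_n` with
`inf_n c_n > 0` satisfying the `ε̃/4` bounds, the function
`L(n,k) = L̃(n) + 1{k∈K_B}·c_n·τ_n(k)` satisfies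
`(QL)(n,k) ≤ −min(ε̃/2, inf_m c_m)` for every `(n,k)` with `n ∉ F̃`. -/
theorem lyapunov_drift_inequality
    {K : Type*} [Fintype K] [Nonempty K]
    (KW : Set K) (hKW : KW.Nonempty)
    (lam mu : ℕ → ℝ) (R V : ℕ → K → K → ℝ)
    (hlam : ∀ n, 0 < lam n)
    (hmu0 : mu 0 = 0) (hmu : ∀ n, 0 < n → 0 < mu n)
    (hRnn : ∀ n, 0 < n → ∀ k m, 0 ≤ R n k m)
    (hRrow : ∀ n, 0 < n → ∀ k, ∑ m : K, R n k m = 1)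
    (hVoff : ∀ n k m, m ≠ k → 0 ≤ V n k m)
    (hVrow : ∀ n k, ∑ m : K, V n k m = 0)
    (Lt : ℕ → ℝ) (hLt : ∀ n, 0 ≤ Lt n)
    (Ft : Finset ℕ) (et : ℝ) (het : 0 < et)
    (hdrift0 : 0 ∉ Ft → lam 0 * (Lt 1 - Lt 0) ≤ -et)
    (hdrift : ∀ n ∉ Ft, 0 < n →
      lam n * (Lt (n + 1) - Lt n) + mu n * (Lt (n - 1) - Lt n) ≤ -et)
    (tau : ℕ → K → ℝ)
    (htauW : ∀ n, ∀ l ∈ KW, tau n l = 0)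
    (htauB : ∀ n, ∀ l ∈ KWᶜ, 0 < tau n l)
    (htauFE : ∀ n, ∀ k ∈ KWᶜ, (-1 : ℝ) =
      (∑ l : K, if l ∈ KWᶜ ∧ l ≠ k then V n k l * (tau n l - tau n k) else 0)
        - (∑ l : K, if l ∈ KW then V n k l * tau n k else 0))
    (c : ℕ → ℝ) (hcinf : 0 < ⨅ n, c n)
    (hc1 : ∀ n, ∀ k ∈ KW,
      c n * (mu (n + 1) * ∑ l : K, (if l ∈ KWᶜ then R (n + 1) k l * tau n l else 0))
        ≤ et / 4)
    (hc2 : ∀ n, ∀ k ∈ KW,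
      c n * (∑ l : K, (if l ∈ KWᶜ then V n k l * tau n l else 0)) ≤ et / 4) :
    ∀ (n : ℕ) (k : K), n ∉ Ft →
      (∑' z : ℕ × K, qgen KW lam mu R V (n, k) z *
          (Lt z.1 + (if z.2 ∈ KWᶜ then c z.1 * tau z.1 z.2 else 0)))
        ≤ -(min (et / 2) (⨅ m, c m)) := by
  intro n k hn
  have hL : ∀ m l, (if l ∈ KWᶜ then c m * tau m l else 0) = c m * tau m l := by
    intro m l
    by_cases hl : l ∈ KW
    · simp [hl, htauW m l hl]
    · simp [hl]
  have hsum : ∀ (m : ℕ) (a : K → ℝ),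
      ∑ l : K, (if l ∈ KWᶜ then a l * tau m l else 0) = ∑ l : K, a l * tau m l := by
    intro m a
    refine Finset.sum_congr rfl fun l _ => ?_
    by_cases hl : l ∈ KW
    · simp [hl, htauW m l hl]
    · simp [hl]
  simp only [hsum] at hc1 hc2
  simp only [hL]
  by_cases hk : k ∈ KW
  · refine le_trans ?_ (neg_le_neg (min_le_left _ _))
    have hV : ∀ m, ∑ l : K, V m k l * (Lt m + c m * tau m l - (Lt m + c m * tau m k)) ≤
        et / 4 := by
      intro m
      refine le_of_eq_of_le ?_ (hc2 m k hk)
      rw [htauW m k hk, Finset.mul_sum]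
      exact Finset.sum_congr rfl fun l _ => by ring
    rcases n with _ | n
    · rw [tsum_qgen_mul_zero]
      have h1 := hV 0
      have h2 := hdrift0 hn
      simp only [hk, if_true, htauW _ k hk, mul_zero, add_zero] at h1 ⊢
      linarith
    · rw [tsum_qgen_mul_succ]
      have h1 := hV (n + 1)
      have h2 := hdrift (n + 1) hn n.succ_pos
      have h3 := hc1 n k hk
      have hR : ∑ l : K, mu (n + 1) * R (n + 1) k l * (Lt n + c n * tau n l - Lt (n + 1)) =
          mu (n + 1) * (Lt n - Lt (n + 1)) +
            c n * (mu (n + 1) * ∑ l : K, R (n + 1) k l * tau n l) := by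
        have hrow := hRrow (n + 1) n.succ_pos k
        calc _ = ∑ l : K, (mu (n + 1) * (Lt n - Lt (n + 1)) * R (n + 1) k l +
              c n * (mu (n + 1) * (R (n + 1) k l * tau n l))) :=
              Finset.sum_congr rfl fun l _ => by ring
          _ = _ := by
            rw [Finset.sum_add_distrib, ← Finset.mul_sum, hrow, ← Finset.mul_sum,
              ← Finset.mul_sum, mul_one]
      simp only [hk, if_true, htauW _ k hk, mul_zero, add_zero, add_tsub_cancel_right]
        at h1 h2 ⊢
      rw [hR]
      linarith
  · refine le_trans ?_ (neg_le_neg (min_le_right _ _))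
    have hbdd : BddBelow (Set.range c) := by
      by_contra h
      rw [iInf, Real.sInf_of_not_bddBelow h] at hcinf
      exact hcinf.false
    have hV : ∑ l : K, V n k l * (Lt n + c n * tau n l - (Lt n + c n * tau n k)) = -c n := by
      have h := sum_mul_sub_eq_neg_one_of_firstEntrance KW (V n) (tau n) (htauW n) k
        (htauFE n k hk)
      calc _ = c n * ∑ l : K, V n k l * (tau n l - tau n k) := by
            rw [Finset.mul_sum]
            exact Finset.sum_congr rfl fun l _ => by ring
        _ = _ := by rw [h, mul_neg_one]
    have hc := ciInf_le hbdd n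
    rcases n with _ | n
    · rw [tsum_qgen_mul_zero]
      simp only [hV, hk, if_false, zero_mul, add_zero]
      exact neg_le_neg hc
    · rw [tsum_qgen_mul_succ]
      simp only [hV, hk, if_false, zero_mul, add_zero, Finset.sum_const_zero, zero_add]
      exact neg_le_neg hc
end
end

section
/- Assume K is finite, ∑_{n=0}^∞ ∏_{m=1}^{n} λ(m−1)/μ(m) < ∞, for each n ∈ ℕ there is τ_n : K → ℝ with τ_n = 0 on K_W, τ_n > 0 on K_B satisfying the first-entrance equations, and there exists ĉ > 0 such that for every n ∈ ℕ and every k ∈ K_W: ĉ·μ(n+1)·∑_{ℓ∈K_B} R_{n+1}(k,ℓ)·τ_n(ℓ) ≤ 1 and ĉ·∑_{ℓ∈K_B} v_n(k,ℓ)·τ_n(ℓ) ≤ 1. Then there exist a function L : E → ℝ≥0, a finite set F ⊆ E and a constant ε > 0 such that ∑_{z̃∈E} q(z; z̃)·L(z̃) ≤ −ε for every z ∈ E \ F. (Corollary 4.9, Lyapunov-function form) -/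
open scoped Classical

noncomputable section

theorem hasSum_qoff_mul {K : Type*} [Fintype K] (KW : Set K) (lam mu : ℕ → ℝ)
    (R V : ℕ → K → K → ℝ) (n : ℕ) (k : K) (f : ℕ × K → ℝ) :
    HasSum (fun w => qoff KW lam mu R V (n + 1, k) w * f w)
      ((if k ∈ KW then lam (n + 1) * f (n + 2, k) else 0)
        + (if k ∈ KW then mu (n + 1) * ∑ l, R (n + 1) k l * f (n, l) else 0)
        + ∑ l, if l = k then 0 else V (n + 1) k l * f (n + 1, l)) := by
  have h := hasSum_sum_of_ne_finset_zero (L := SummationFilter.unconditional (ℕ × K))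
    (f := fun w => qoff KW lam mu R V (n + 1, k) w * f w)
    (s := ({n + 2, n, n + 1} : Finset ℕ) ×ˢ (Finset.univ : Finset K)) (by
      rintro ⟨m, l⟩ hml
      have hm : m ≠ n + 2 ∧ m ≠ n ∧ m ≠ n + 1 := by simpa using hml
      simp [qoff, hm.1, hm.2.1, hm.2.2])
  convert h using 1
  rw [Finset.sum_product, Finset.sum_insert (by simp), Finset.sum_insert (by simp),
    Finset.sum_singleton, ← add_assoc]
  congr 1
  · congr 1
    · simp [qoff]
    · split_ifs with hk
      · simp [qoff, hk, Finset.mul_sum, mul_assoc, show n ≠ n + 1 + 1 by lia]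
      · simp [qoff, hk]
  · refine Finset.sum_congr rfl fun l _ => ?_
    by_cases hl : l = k <;> simp [qoff, hl]

theorem hasSum_qgen_mul {K : Type*} [Fintype K] (KW : Set K) (lam mu : ℕ → ℝ)
    (R V : ℕ → K → K → ℝ) (n : ℕ) (k : K) (hR : ∑ l, R (n + 1) k l = 1) (f : ℕ × K → ℝ) :
    HasSum (fun w => qgen KW lam mu R V (n + 1, k) w * f w)
      ((if k ∈ KW then lam (n + 1) * (f (n + 2, k) - f (n + 1, k)) else 0)
        + (if k ∈ KW then mu (n + 1) * (∑ l, R (n + 1) k l * f (n, l) - f (n + 1, k)) else 0)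
        + ∑ l, V (n + 1) k l * (f (n + 1, l) - f (n + 1, k))) := by
  have h1 := hasSum_qoff_mul KW lam mu R V n k f
  have h2 := hasSum_qoff_mul KW lam mu R V n k fun _ => 1
  simp only [mul_one] at h2
  have h3 := h1.sub (hasSum_ite_eq (n + 1, k)
    ((∑' w, qoff KW lam mu R V (n + 1, k) w) * f (n + 1, k)))
  have hfun : (fun w => qgen KW lam mu R V (n + 1, k) w * f w) = fun w =>
      qoff KW lam mu R V (n + 1, k) w * f w - if w = (n + 1, k) then
        (∑' w, qoff KW lam mu R V (n + 1, k) w) * f (n + 1, k) else 0 := by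
    funext w
    by_cases hw : w = (n + 1, k)
    · subst hw
      simp [qgen, qoff]
    · simp [qgen, hw]
  rw [hfun]
  have hV : ∑ l, V (n + 1) k l * (f (n + 1, l) - f (n + 1, k))
      = (∑ l, if l = k then 0 else V (n + 1) k l * f (n + 1, l))
        - (∑ l, if l = k then 0 else V (n + 1) k l) * f (n + 1, k) := by
    rw [Finset.sum_mul, ← Finset.sum_sub_distrib]
    refine Finset.sum_congr rfl fun l _ => ?_
    by_cases hl : l = k
    · simp [hl]
    · simp [hl, mul_sub]
  rw [show (if k ∈ KW then lam (n + 1) * (f (n + 2, k) - f (n + 1, k)) else 0)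
      + (if k ∈ KW then mu (n + 1) * (∑ l, R (n + 1) k l * f (n, l) - f (n + 1, k)) else 0)
      + ∑ l, V (n + 1) k l * (f (n + 1, l) - f (n + 1, k)) = _ - _ from ?_]
  · exact h3
  · rw [h2.tsum_eq, hV, hR]
    split_ifs <;> ring

/-- The increments of a Lyapunov function for the birth-death chain with rates `lam`, `mu`. -/
theorem exists_birthDeath_increment (lam mu : ℕ → ℝ) (hlam : ∀ n, 0 < lam n)
    (hmu : ∀ n, 0 < n → 0 < mu n)
    (hsum : Summable (fun n : ℕ => ∏ m ∈ Finset.range n, lam m / mu (m + 1))) (c : ℝ)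
    (hc : 0 ≤ c) :
    ∃ d : ℕ → ℝ, (∀ n, 0 ≤ d n) ∧
      ∀ n, lam (n + 1) * d (n + 1) - mu (n + 1) * d n = -c := by
  set w : ℕ → ℝ := fun n => ∏ m ∈ Finset.range n, lam m / mu (m + 1) with hw
  have hwpos : ∀ n, 0 < w n := fun n =>
    Finset.prod_pos fun m _ => div_pos (hlam m) (hmu _ m.succ_pos)
  set T : ℕ → ℝ := fun n => ∑' i, w (i + (n + 1)) with hT
  refine ⟨fun n => c * T n / (lam n * w n), fun n => ?_, fun n => ?_⟩
  · exact div_nonneg (mul_nonneg hc (tsum_nonneg fun i => (hwpos _).le))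
      (mul_pos (hlam n) (hwpos n)).le
  · have hTn : T n = w (n + 1) + T (n + 1) := by
      have h := ((summable_nat_add_iff (n + 1)).2 hsum).tsum_eq_zero_add
      simp only [hT]
      rw [h, zero_add]
      congr 1
      refine tsum_congr fun i => ?_
      congr 1
      omega
    have hwn : w (n + 1) = w n * (lam n / mu (n + 1)) := Finset.prod_range_succ _ _
    have h0 := (hwpos n).ne'
    have h1 := (hlam n).ne'
    have h2 := (hlam (n + 1)).ne'
    have h3 := (hmu (n + 1) n.succ_pos).ne'
    simp only
    rw [hTn, hwn]
    field_simp
    ring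

/-- Corollary 4.9 (Lyapunov-function form): if `K` is finite, the birth-death series
`∑_n ∏_{m=1}^n λ(m−1)/μ(m)` converges, first-entrance-time functions `τ_n` exist, and a
uniform constant `ĉ > 0` bounds the environment passage terms, then there is a Lyapunov
function for the queueing-environment process: a nonnegative `L`, a finite exception set
`F` and `ε > 0` with `(QL)(z) ≤ −ε` for all `z ∉ F`. -/
theorem lyapunov_function_exists
    {K : Type*} [Fintype K] [Nonempty K]
    (KW : Set K) (hKW : KW.Nonempty)
    (lam mu : ℕ → ℝ) (R V : ℕ → K → K → ℝ)
    (hlam : ∀ n, 0 < lam n)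
    (hmu0 : mu 0 = 0) (hmu : ∀ n, 0 < n → 0 < mu n)
    (hRnn : ∀ n, 0 < n → ∀ k m, 0 ≤ R n k m)
    (hRrow : ∀ n, 0 < n → ∀ k, ∑ m : K, R n k m = 1)
    (hVoff : ∀ n k m, m ≠ k → 0 ≤ V n k m)
    (hVrow : ∀ n k, ∑ m : K, V n k m = 0)
    (hsum : Summable (fun n : ℕ => ∏ m ∈ Finset.range n, lam m / mu (m + 1)))
    (tau : ℕ → K → ℝ)
    (htauW : ∀ n, ∀ l ∈ KW, tau n l = 0)
    (htauB : ∀ n, ∀ l ∈ KWᶜ, 0 < tau n l)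
    (htauFE : ∀ n, ∀ k ∈ KWᶜ, (-1 : ℝ) =
      (∑ l : K, if l ∈ KWᶜ ∧ l ≠ k then V n k l * (tau n l - tau n k) else 0)
        - (∑ l : K, if l ∈ KW then V n k l * tau n k else 0))
    (chat : ℝ) (hchat : 0 < chat)
    (hc1 : ∀ n, ∀ k ∈ KW,
      chat * (mu (n + 1) * ∑ l : K, (if l ∈ KWᶜ then R (n + 1) k l * tau n l else 0)) ≤ 1)
    (hc2 : ∀ n, ∀ k ∈ KW,
      chat * (∑ l : K, (if l ∈ KWᶜ then V n k l * tau n l else 0)) ≤ 1) :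
    ∃ (L : ℕ × K → ℝ) (F : Set (ℕ × K)) (eps : ℝ),
      (∀ z, 0 ≤ L z) ∧ F.Finite ∧ 0 < eps ∧
        ∀ z ∉ F, (∑' z' : ℕ × K, qgen KW lam mu R V z z' * L z') ≤ -eps := by
  obtain ⟨d, hd0, hd⟩ := exists_birthDeath_increment lam mu hlam hmu hsum 3 (by norm_num)
  have htau0 : ∀ n k, 0 ≤ tau n k := fun n k => by
    by_cases hk : k ∈ KW
    · exact (htauW n k hk).ge
    · exact (htauB n k hk).le
  refine ⟨fun z => ∑ i ∈ Finset.range z.1, d i + chat * tau z.1 z.2, {z | z.1 = 0},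
    min 1 chat, fun z => ?_, ?_, lt_min one_pos hchat, ?_⟩
  · exact add_nonneg (Finset.sum_nonneg fun i _ => hd0 i) (mul_nonneg hchat.le (htau0 _ _))
  · refine ((Set.finite_singleton 0).prod (Set.finite_univ (α := K))).subset ?_
    rintro ⟨n, k⟩ hn
    exact ⟨hn, trivial⟩
  rintro ⟨n, k⟩ hz
  obtain ⟨n, rfl⟩ := Nat.exists_eq_succ_of_ne_zero (n := n) hz
  have hR := hRrow (n + 1) n.succ_pos k
  rw [Nat.succ_eq_add_one, (hasSum_qgen_mul KW lam mu R V n k hR _).tsum_eq]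
  simp only [add_sub_add_left_eq_sub, ← mul_sub]
  by_cases hk : k ∈ KW
  · refine le_trans ?_ (neg_le_neg (min_le_left _ _))
    have e1 : (∑ l, if l ∈ KWᶜ then R (n + 1) k l * tau n l else 0)
        = ∑ l, R (n + 1) k l * tau n l := Finset.sum_congr rfl fun l _ => by
      by_cases hl : l ∈ KW <;> simp [hl, htauW]
    have e2 : (∑ l, if l ∈ KWᶜ then V (n + 1) k l * tau (n + 1) l else 0)
        = ∑ l, V (n + 1) k l * tau (n + 1) l := Finset.sum_congr rfl fun l _ => by
      by_cases hl : l ∈ KW <;> simp [hl, htauW]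
    have e3 : ∑ l, R (n + 1) k l * (∑ i ∈ Finset.range n, d i + chat * tau n l)
        = ∑ i ∈ Finset.range n, d i + chat * ∑ l, R (n + 1) k l * tau n l := by
      simp only [mul_add, Finset.sum_add_distrib, mul_left_comm _ chat]
      rw [← Finset.sum_mul, hR, one_mul, ← Finset.mul_sum]
    have e4 : ∑ l, V (n + 1) k l * (chat * tau (n + 1) l)
        = chat * ∑ l, V (n + 1) k l * tau (n + 1) l := by
      simp only [Finset.mul_sum, mul_left_comm chat]
    have h1 := hc1 n k hk
    have h2 := hc2 (n + 1) k hk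
    rw [e1] at h1
    rw [e2] at h2
    simp only [hk, if_true, htauW _ k hk, mul_zero, add_zero, sub_zero, e3, e4,
      Finset.sum_range_succ]
    linarith [hd n]
  · refine le_trans (le_of_eq ?_) (neg_le_neg (min_le_right _ _))
    have h := htauFE (n + 1) k hk
    rw [← Finset.sum_sub_distrib] at h
    simp only [hk, if_false, zero_add, mul_left_comm _ chat, ← Finset.mul_sum]
    rw [neg_eq_neg_one_mul, mul_comm (-1), h]
    congr 1
    refine Finset.sum_congr rfl fun l _ => ?_
    by_cases hl : l ∈ KW
    · simp [hl, htauW]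
    · by_cases hlk : l = k <;> simp [hl, hlk, hk]
end
end

section
/- Consider the separable perishable queueing-inventory generator with base stock level b ≥ 1, ageing regime d : {1,…,b} → ℝ≥0, and rates λ, μ, ν, γ > 0 with λ < μ. Define π : ℕ × {0,…,b} → ℝ by π(n,k) = (1 − λ/μ)·(λ/μ)^n·C_θ^{−1}·∏_{ℓ=1}^{k} ν/(λ + γ·d(ℓ)), where C_θ = ∑_{k=0}^{b} ∏_{ℓ=1}^{k} ν/(λ + γ·d(ℓ)). Then π is nonnegative, ∑_{(n,k)} π(n,k) = 1, and π satisfies the global balance equations ∑_{z∈E} π(z)·q(z;z̃) = 0 for every z̃ ∈ E. (Product form of Example 5.1) -/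
open scoped Classical

noncomputable section

/-- Separable perishable queueing-inventory generator with base stock level `b` and ageing
regime `d` on `E = ℕ × {0,…,b}`: arrivals `(n,k) → (n+1,k)` at rate `λ·1{1 ≤ k}`,
perishing `(n,k) → (n,k−1)` at rate `γ·d(k)·1{1 ≤ k}`, service `(n,k) → (n−1,k−1)` at rate
`μ·1{n>0}·1{1 ≤ k}`, replenishments `(n,k) → (n,k+1)` at rate `ν·1{k ≤ b−1}`, with
conservative diagonal. -/
def qSP (b : ℕ) (lam mu nu gam : ℝ) (d : ℕ → ℝ) :
    (ℕ × Fin (b + 1)) → (ℕ × Fin (b + 1)) → ℝ := fun z z' =>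
  if z' = z then
    -((if 1 ≤ z.2.val then lam else 0)
      + (if 1 ≤ z.2.val then gam * d z.2.val else 0)
      + (if 0 < z.1 ∧ 1 ≤ z.2.val then mu else 0)
      + (if z.2.val < b then nu else 0))
  else if z'.1 = z.1 + 1 ∧ z'.2 = z.2 ∧ 1 ≤ z.2.val then lam
  else if z'.1 = z.1 ∧ z'.2.val + 1 = z.2.val then gam * d z.2.val
  else if z'.1 + 1 = z.1 ∧ z'.2.val + 1 = z.2.val then mu
  else if z'.1 = z.1 ∧ z'.2.val = z.2.val + 1 then nu
  else 0

/-- The column of `qSP` at `(m, j)`, split according to the possible predecessor states. -/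
lemma qSP_column (b : ℕ) (lam mu nu gam : ℝ) (d : ℕ → ℝ) (m : ℕ) (j : Fin (b + 1))
    (z : ℕ × Fin (b + 1)) :
    qSP b lam mu nu gam d z (m, j) =
      (if z = (m, j) then
        -((if 1 ≤ j.val then lam else 0) + (if 1 ≤ j.val then gam * d j.val else 0)
          + (if 0 < m ∧ 1 ≤ j.val then mu else 0) + (if j.val < b then nu else 0)) else 0)
      + (if z = (m - 1, j) then (if 0 < m ∧ 1 ≤ j.val then lam else 0) else 0)
      + (if z = (m, ⟨min (j.val + 1) b, by omega⟩) then
          (if j.val < b then gam * d (j.val + 1) else 0) else 0)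
      + (if z = (m + 1, ⟨min (j.val + 1) b, by omega⟩) then (if j.val < b then mu else 0) else 0)
      + (if z = (m, ⟨j.val - 1, by omega⟩) then (if 1 ≤ j.val then nu else 0) else 0) := by
  obtain ⟨n, k, hk⟩ := z
  obtain ⟨j, hj⟩ := j
  simp only [qSP, Prod.mk.injEq, Fin.mk.injEq]
  by_cases h : m = n ∧ j = k
  · obtain ⟨rfl, rfl⟩ := h
    grind
  · grind (splits := 20)

/-- Total flow into `(m, j)`, diagonal included, under an arbitrary weight on the states. -/
lemma hasSum_mul_qSP (b : ℕ) (lam mu nu gam : ℝ) (d : ℕ → ℝ) (w : ℕ → ℕ → ℝ) (m : ℕ)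
    (j : Fin (b + 1)) :
    HasSum (fun z : ℕ × Fin (b + 1) => w z.1 z.2.val * qSP b lam mu nu gam d z (m, j))
      (w m j.val *
        -((if 1 ≤ j.val then lam else 0) + (if 1 ≤ j.val then gam * d j.val else 0)
          + (if 0 < m ∧ 1 ≤ j.val then mu else 0) + (if j.val < b then nu else 0))
      + w (m - 1) j.val * (if 0 < m ∧ 1 ≤ j.val then lam else 0)
      + w m (min (j.val + 1) b) * (if j.val < b then gam * d (j.val + 1) else 0)
      + w (m + 1) (min (j.val + 1) b) * (if j.val < b then mu else 0)
      + w m (j.val - 1) * (if 1 ≤ j.val then nu else 0)) := by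
  have point_mass (a : ℕ × Fin (b + 1)) (c : ℝ) :
      HasSum (fun z : ℕ × Fin (b + 1) => w z.1 z.2.val * (if z = a then c else 0))
        (w a.1 a.2.val * c) := by
    convert hasSum_ite_eq a (w a.1 a.2.val * c) using 2 with z
    split_ifs with h
    · rw [h]
    · simp
  simp only [qSP_column, mul_add]
  exact ((((point_mass (m, j) _).add (point_mass (m - 1, j) _)).add
    (point_mass (m, ⟨min (j.val + 1) b, by omega⟩) _)).add
    (point_mass (m + 1, ⟨min (j.val + 1) b, by omega⟩) _)).add
    (point_mass (m, ⟨j.val - 1, by omega⟩) _)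

/-- A weight that is geometric with ratio `lam / mu` in the queue length and satisfies the
inventory cut equations is invariant for `qSP`. -/
lemma hasSum_mul_qSP_eq_zero {b : ℕ} {lam mu nu gam : ℝ} {d : ℕ → ℝ} {w : ℕ → ℕ → ℝ}
    (hqueue : ∀ n k, mu * w (n + 1) k = lam * w n k)
    (hstock : ∀ n, ∀ k < b, (lam + gam * d (k + 1)) * w n (k + 1) = nu * w n k)
    (z' : ℕ × Fin (b + 1)) :
    HasSum (fun z : ℕ × Fin (b + 1) => w z.1 z.2.val * qSP b lam mu nu gam d z z') 0 := by
  obtain ⟨m, j⟩ := z'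
  convert hasSum_mul_qSP b lam mu nu gam d w m j using 1
  obtain ⟨j, hj⟩ := j
  have service : w m j * (if 0 < m ∧ 1 ≤ j then mu else 0)
      = w (m - 1) j * (if 0 < m ∧ 1 ≤ j then lam else 0) := by
    split_ifs with h
    · have := hqueue (m - 1) j
      rw [Nat.sub_add_cancel h.1] at this
      linarith
    · simp
  have replenish : w m (j - 1) * (if 1 ≤ j then nu else 0)
      = w m j * ((if 1 ≤ j then lam else 0) + (if 1 ≤ j then gam * d j else 0)) := by
    split_ifs with h
    · have := hstock m (j - 1) (by omega)
      rw [Nat.sub_add_cancel h] at this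
      linarith
    · simp
  have deplete : w m j * (if j < b then nu else 0)
      = w m (min (j + 1) b) * (if j < b then gam * d (j + 1) else 0)
        + w (m + 1) (min (j + 1) b) * (if j < b then mu else 0) := by
    split_ifs with h
    · rw [min_eq_left (Nat.succ_le_of_lt h)]
      linarith [hstock m j h, hqueue m (j + 1)]
    · simp
  linear_combination service - replenish + deplete

/-- Product form of Example 5.1: the separable perishable queueing-inventory system with
queue-length independent ageing regime `d` has stationary distribution
`π(n,k) = (1 − λ/μ)·(λ/μ)^n·C_θ⁻¹·∏_{ℓ=1}^{k} ν/(λ + γ·d(ℓ))`. -/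
theorem separable_perishable_product_form
    (b : ℕ) (hb : 1 ≤ b) (lam mu nu gam : ℝ) (d : ℕ → ℝ)
    (hlam : 0 < lam) (hmu : 0 < mu) (hnu : 0 < nu) (hgam : 0 < gam)
    (hd : ∀ k, 1 ≤ k → k ≤ b → 0 ≤ d k)
    (hstab : lam < mu) :
    (∀ z : ℕ × Fin (b + 1), 0 ≤
        (1 - lam / mu) * (lam / mu) ^ z.1 *
          (∑ k ∈ Finset.range (b + 1),
            ∏ l ∈ Finset.range k, nu / (lam + gam * d (l + 1)))⁻¹ *
          ∏ l ∈ Finset.range z.2.val, nu / (lam + gam * d (l + 1))) ∧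
    (∑' z : ℕ × Fin (b + 1),
        (1 - lam / mu) * (lam / mu) ^ z.1 *
          (∑ k ∈ Finset.range (b + 1),
            ∏ l ∈ Finset.range k, nu / (lam + gam * d (l + 1)))⁻¹ *
          ∏ l ∈ Finset.range z.2.val, nu / (lam + gam * d (l + 1))) = 1 ∧
    (∀ z' : ℕ × Fin (b + 1),
      ∑' z : ℕ × Fin (b + 1),
        ((1 - lam / mu) * (lam / mu) ^ z.1 *
          (∑ k ∈ Finset.range (b + 1),
            ∏ l ∈ Finset.range k, nu / (lam + gam * d (l + 1)))⁻¹ *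
          ∏ l ∈ Finset.range z.2.val, nu / (lam + gam * d (l + 1))) *
          qSP b lam mu nu gam d z z' = 0) := by
  have hden : ∀ k < b, 0 < lam + gam * d (k + 1) := fun k hk =>
    add_pos_of_pos_of_nonneg hlam (mul_nonneg hgam.le (hd _ (by omega) hk))
  set θ : ℕ → ℝ := fun k => ∏ l ∈ Finset.range k, nu / (lam + gam * d (l + 1)) with hθ
  have θ_pos : ∀ k ≤ b, 0 < θ k := fun k hk => Finset.prod_pos fun l hl =>
    div_pos hnu (hden l ((Finset.mem_range.1 hl).trans_le hk))
  set C : ℝ := ∑ k ∈ Finset.range (b + 1), θ k with hC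
  have C_pos : 0 < C := Finset.sum_pos
    (fun k hk => θ_pos k (Nat.lt_succ_iff.1 (Finset.mem_range.1 hk))) ⟨0, by simp⟩
  have ratio_nonneg : 0 ≤ lam / mu := (div_pos hlam hmu).le
  have ratio_lt_one : lam / mu < 1 := (div_lt_one hmu).2 hstab
  refine ⟨fun z => ?_, ?_, fun z' => ?_⟩
  · have := θ_pos z.2.val (Nat.lt_succ_iff.1 z.2.isLt)
    have : 0 < 1 - lam / mu := sub_pos.2 ratio_lt_one
    positivity
  · have queue : HasSum (fun n : ℕ => (1 - lam / mu) * (lam / mu) ^ n) 1 := by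
      simpa [mul_inv_cancel₀ (sub_pos.2 ratio_lt_one).ne'] using
        (hasSum_geometric_of_lt_one ratio_nonneg ratio_lt_one).mul_left (1 - lam / mu)
    have stock : HasSum (fun k : Fin (b + 1) => C⁻¹ * θ k.val) 1 := by
      convert hasSum_fintype (fun k : Fin (b + 1) => C⁻¹ * θ k.val) using 1
      rw [← Finset.mul_sum, Fin.sum_univ_eq_sum_range θ, ← hC, inv_mul_cancel₀ C_pos.ne']
    have summable_prod := queue.summable.mul_of_nonneg stock.summable
      (fun n => mul_nonneg (sub_pos.2 ratio_lt_one).le (pow_nonneg ratio_nonneg n))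
      (fun k => mul_nonneg (inv_pos.2 C_pos).le (θ_pos k.val (Nat.lt_succ_iff.1 k.isLt)).le)
    simpa only [hθ, mul_assoc, mul_one] using (queue.mul stock summable_prod).tsum_eq
  · refine (hasSum_mul_qSP_eq_zero
      (w := fun n k => (1 - lam / mu) * (lam / mu) ^ n * C⁻¹ * θ k) ?_ ?_ z').tsum_eq
    · intro n k
      have : mu * (lam / mu) = lam := mul_div_cancel₀ lam hmu.ne'
      rw [pow_succ]
      linear_combination (1 - lam / mu) * (lam / mu) ^ n * C⁻¹ * θ k * this
    · intro n k hk
      have step : θ (k + 1) = θ k * (nu / (lam + gam * d (k + 1))) := Finset.prod_range_succ _ _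
      rw [step]
      have := mul_div_cancel₀ nu (hden k hk).ne'
      linear_combination (1 - lam / mu) * (lam / mu) ^ n * C⁻¹ * θ k * this
end
end

section
/- Let λ, μ, ν, γ > 0 with λ < μ, and let π be the stationary distribution of the perishable queueing-inventory system with base stock level b = 1, i.e. π(0,0) = C^{−1}·(λ+γ)/ν, π(n,0) = C^{−1}·(λ/μ)^n·(λ/ν) for n > 0, π(n,1) = C^{−1}·(λ/μ)^n for n ≥ 0, with C = (μ/(μ−λ))·(1 + λ/ν) + γ/ν. Then the throughput TH^o := ∑_{n=1}^∞ π(n,1)·μ equals λμν/(μ·(λ+ν) + γ·(μ−λ)). (Throughput computation for the 'o'-system with b = 1) -/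
open scoped Classical

noncomputable section

/-- Throughput computation for the 'o'-system with `b = 1`:
`TH^o = ∑_{n=1}^∞ π(n,1)·μ = λμν/(μ·(λ+ν) + γ·(μ−λ))`. -/
theorem throughput_o_system
    (lam mu nu gam : ℝ)
    (hlam : 0 < lam) (hnu : 0 < nu) (hgam : 0 < gam)
    (hstab : lam < mu) :
    (∑' n : ℕ, piPer lam mu nu gam (n + 1, (1 : Fin 2)) * mu)
      = lam * mu * nu / (mu * (lam + nu) + gam * (mu - lam)) := by
  have hmu : 0 < mu := hlam.trans hstab
  have hsub : 0 < mu - lam := sub_pos.mpr hstab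
  have hgeom := hasSum_geometric_of_lt_one (div_pos hlam hmu).le ((div_lt_one hmu).mpr hstab)
  have hsum := hgeom.mul_left
    (((mu / (mu - lam)) * (1 + lam / nu) + gam / nu)⁻¹ * (lam / mu) * mu)
  have hterm : (fun n : ℕ => piPer lam mu nu gam (n + 1, (1 : Fin 2)) * mu) = fun n : ℕ =>
      ((mu / (mu - lam)) * (1 + lam / nu) + gam / nu)⁻¹ * (lam / mu) * mu * (lam / mu) ^ n := by
    funext n
    simp only [piPer, if_true]
    ring
  have hC : (mu / (mu - lam)) * (1 + lam / nu) + gam / nu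
      = (mu * (lam + nu) + gam * (mu - lam)) / ((mu - lam) * nu) := by
    field_simp
    ring
  have hratio : 1 - lam / mu = (mu - lam) / mu := by
    field_simp
  have hden : 0 < mu * (lam + nu) + gam * (mu - lam) := by positivity
  rw [hterm, hsum.tsum_eq, hC, hratio]
  field_simp
end
end
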